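/- Let m, n ≥ 4. The concatenation L'_m(a,b) · L_n(a,-,b,d), regarded as a language over the alphabet {a,b,d}, has state complexity exactly m·2^{n-1} + 1, where L'_m(a,b) ⊆ {a,b}* and L_n(a,-,b,d) ⊆ {a,b,d}* with b inducing the transformation originally induced by c and d as in D_n. -/

import Mathlib

/-- Left quotient of a language by a word. -/
def leftQuot {α : Type} (L : Set (List α)) (w : List α) : Set (List α) := {x | w ++ x ∈ L}

/-- The set of left quotients of `L`. -/
def quotients {α : Type} (L : Set (List α)) : Set (Set (List α)) :=
  Set.range (leftQuot L)

/-- The state complexity of `L` (here over the whole alphabet `{a,b,d}`). -/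
noncomputable def stateComplexity {α : Type} (L : Set (List α)) : ℕ :=
  Nat.card (quotients L)

/-- Concatenation (product) of two languages. -/
def concat {α : Type} (L1 L2 : Set (List α)) : Set (List α) :=
  {w | ∃ u v, u ∈ L1 ∧ v ∈ L2 ∧ w = u ++ v}

/-- The three-letter alphabet `{a,b,d}`. -/
inductive ABD : Type
  | a | b | d
  deriving DecidableEq

/-- The transitions of `D'_m(a,b)` (the letter `d` is not in its alphabet; its words
are restricted to `{a,b}` below, so the value on `d` is irrelevant):
`a : (1,…,m-1)(0→1)`, `b : (1,2)(0→2)`. -/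
def stepM (m : ℕ) (q : ℕ) : ABD → ℕ
  | ABD.a => if q = m - 1 then 1 else q + 1
  | ABD.b => if q = 0 then 2 else if q = 1 then 2 else if q = 2 then 1 else q
  | ABD.d => q

/-- The DFA `D'_m(a,b)`, initial state `0`, final state `m-1`. -/
def DmAB (m : ℕ) : DFA ABD ℕ := ⟨stepM m, 0, {m - 1}⟩

/-- The language `L'_m(a,b) ⊆ {a,b}*`. -/
def LmAB (m : ℕ) : Set (List ABD) :=
  {w | (∀ x ∈ w, x ≠ ABD.d) ∧ w ∈ (DmAB m).accepts}

/-- The transitions of the dialect `D_n(a,-,b,d)`: `a` as usual, the letter `b` induces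
the transformation of the original `c`, namely `(2,…,n-1)(1→2)(0→1)`, and `d : (0→2)`. -/
def stepN (n : ℕ) (q : ℕ) : ABD → ℕ
  | ABD.a => if q = n - 1 then 1 else q + 1
  | ABD.b => if q = n - 1 then 2 else q + 1
  | ABD.d => if q = 0 then 2 else q

/-- The DFA `D_n(a,-,b,d)`, initial state `0`, final state `n-1`. -/
def DnABD (n : ℕ) : DFA ABD ℕ := ⟨stepN n, 0, {n - 1}⟩

/-- The language `L_n(a,-,b,d) ⊆ {a,b,d}*`. -/
def LnABD (n : ℕ) : Set (List ABD) := (DnABD n).accepts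


namespace Prod16

/-- First component of the subset automaton; `m` is the dead state. -/
def stK (m k : ℕ) (x : ABD) : ℕ := if x = ABD.d ∨ k = m then m else stepM m k x

/-- Contribution of the final state of the first automaton. -/
def zr (m k : ℕ) : Finset ℕ := if k = m - 1 then {0} else ∅

def stp (m n : ℕ) (s : ℕ × Finset ℕ) (x : ABD) : ℕ × Finset ℕ :=
  (stK m s.1 x, (s.2 ∪ zr m s.1).image (fun q => stepN n q x))

def run (m n : ℕ) (s : ℕ × Finset ℕ) (w : List ABD) : ℕ × Finset ℕ := w.foldl (stp m n) s

def Acc (m n : ℕ) (s : ℕ × Finset ℕ) : Set (List ABD) := {x | n - 1 ∈ (run m n s x).2}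

def Rch (m n : ℕ) (s : ℕ × Finset ℕ) : Prop := ∃ w, run m n (0, ∅) w = s

lemma mem_zr (m k q : ℕ) : q ∈ zr m k ↔ k = m - 1 ∧ q = 0 := by
  unfold zr; split_ifs <;> simp [*]

lemma eval_lt (m : ℕ) (hm : 4 ≤ m) (w : List ABD) : (DmAB m).eval w < m := by
  induction w using List.reverseRecOn with
  | nil => simp [DmAB]; omega
  | append_singleton w x ih =>
    rw [DFA.eval_append_singleton]
    generalize (DmAB m).eval w = q at *
    cases x <;> simp only [DmAB, stepM] <;> (try split_ifs) <;> omega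

lemma run_snoc (m n : ℕ) (s w x) : run m n s (w ++ [x]) = stp m n (run m n s w) x := by
  simp [run]

lemma run_fst (m n : ℕ) (hm : 4 ≤ m) (w : List ABD) :
    (run m n (0, ∅) w).1 = if ABD.d ∈ w then m else (DmAB m).eval w := by
  induction w using List.reverseRecOn with
  | nil => simp [run, DmAB]
  | append_singleton w x ih =>
    rw [run_snoc, DFA.eval_append_singleton]
    simp only [stp, stK, ih]
    have h := eval_lt m hm w
    by_cases hd : ABD.d ∈ w
    · simp [hd]
    · simp only [hd, if_false, List.mem_append, List.mem_singleton, false_or]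
      by_cases hx : x = ABD.d
      · simp [hx]
      · have : ABD.d ≠ x := fun h => hx h.symm
        have hne := h.ne
        simp only [hx, this, hne, or_self, if_false]; rfl

lemma mem_Lm (m : ℕ) (w : List ABD) : w ∈ LmAB m ↔ ABD.d ∉ w ∧ (DmAB m).eval w = m - 1 := by
  constructor
  · rintro ⟨h1, h2⟩
    exact ⟨fun h => h1 _ h rfl, h2⟩
  · rintro ⟨h1, h2⟩
    exact ⟨fun x hx h => h1 (h ▸ hx), h2⟩

lemma run_snd (m n : ℕ) (hm : 4 ≤ m) (w : List ABD) (q : ℕ) :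
    q ∈ (run m n (0, ∅) w).2 ↔
      ∃ u v, w = u ++ v ∧ v ≠ [] ∧ u ∈ LmAB m ∧ (DnABD n).eval v = q := by
  induction w using List.reverseRecOn generalizing q with
  | nil =>
    constructor
    · simp [run]
    · rintro ⟨u, v, h, hv, -⟩
      simp at h; exact absurd h.2 hv
  | append_singleton w x ih =>
    rw [run_snoc]
    have hf : (run m n (0, ∅) w).1 = m - 1 ↔ w ∈ LmAB m := by
      rw [run_fst m n hm, mem_Lm]
      by_cases hd : ABD.d ∈ w
      · simp [hd]; omega
      · simp [hd]
    simp only [stp, Finset.mem_image, Finset.mem_union, mem_zr, hf]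
    constructor
    · rintro ⟨p, h | ⟨h, rfl⟩, rfl⟩
      · obtain ⟨u, v, rfl, hv, hu, rfl⟩ := (ih p).1 h
        refine ⟨u, v ++ [x], by simp, by simp, hu, ?_⟩
        rw [DFA.eval_append_singleton]; rfl
      · exact ⟨w, [x], rfl, by simp, h, rfl⟩
    · rintro ⟨u, v, h, hv, hu, rfl⟩
      obtain rfl | ⟨v, y, rfl⟩ := List.eq_nil_or_concat v
      · exact absurd rfl hv
      · rw [List.concat_eq_append] at *
        rw [← List.append_assoc] at h
        obtain ⟨rfl, h2⟩ := List.append_inj' h rfl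
        obtain rfl : x = y := by simpa using h2
        refine ⟨(DnABD n).eval v, ?_, by rw [DFA.eval_append_singleton]; rfl⟩
        by_cases hv0 : v = []
        · subst hv0; right; exact ⟨by simpa using hu, rfl⟩
        · left; exact (ih _).2 ⟨u, v, rfl, hv0, hu, rfl⟩

lemma mem_concat (m n : ℕ) (hm : 4 ≤ m) (hn : 4 ≤ n) (w : List ABD) :
    w ∈ concat (LmAB m) (LnABD n) ↔ n - 1 ∈ (run m n (0, ∅) w).2 := by
  rw [run_snd m n hm]
  constructor
  · rintro ⟨u, v, hu, hv, rfl⟩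
    have hv' : (DnABD n).eval v = n - 1 := hv
    refine ⟨u, v, rfl, ?_, hu, hv'⟩
    rintro rfl
    have : (0 : ℕ) = n - 1 := hv'
    omega
  · rintro ⟨u, v, h, -, hu, hv⟩
    exact ⟨u, v, hu, hv, h⟩

lemma leftQuot_eq (m n : ℕ) (hm : 4 ≤ m) (hn : 4 ≤ n) (w : List ABD) :
    leftQuot (concat (LmAB m) (LnABD n)) w = Acc m n (run m n (0, ∅) w) := by
  ext x
  have := mem_concat m n hm hn (w ++ x)
  simpa [leftQuot, Acc, run] using this

def Ok (m n : ℕ) (s : ℕ × Finset ℕ) : Prop := s.1 ≤ m ∧ s.2 ⊆ Finset.Icc 1 (n - 1)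

lemma mem_stp (m n k : ℕ) (T x q) : q ∈ (stp m n (k, T) x).2 ↔
    ∃ p, (p ∈ T ∨ (k = m - 1 ∧ p = 0)) ∧ stepN n p x = q := by
  simp only [stp, Finset.mem_image, Finset.mem_union, mem_zr]

lemma ok_stp (m n : ℕ) (hm : 4 ≤ m) (hn : 4 ≤ n) (s x) (h : Ok m n s) : Ok m n (stp m n s x) := by
  obtain ⟨k, T⟩ := s
  obtain ⟨h1, h2⟩ := h
  simp only at h1 h2
  constructor
  · simp only [stp, stK]
    cases x <;> simp only [stepM] <;> split_ifs <;> omega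
  · intro q hq
    obtain ⟨p, hp, rfl⟩ := (mem_stp ..).1 hq
    have hp' : p ≤ n - 1 := by
      rcases hp with hp | hp
      · exact (Finset.mem_Icc.1 (h2 hp)).2
      · omega
    rw [Finset.mem_Icc]
    cases x <;> simp only [stepN] <;> split_ifs <;> omega

lemma acc_stp (m n : ℕ) {s s'} (x) (h : Acc m n s = Acc m n s') :
    Acc m n (stp m n s x) = Acc m n (stp m n s' x) := by
  ext w
  have : x :: w ∈ Acc m n s ↔ x :: w ∈ Acc m n s' := by rw [h]
  exact this

lemma dead_a (m n : ℕ) (hm : 4 ≤ m) (hn : 4 ≤ n) (j : ℕ) : ∀ (T : Finset ℕ) (q : ℕ),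
    T ⊆ Finset.Icc 1 (n - 1) → 1 ≤ q → q + j = n - 1 →
    (List.replicate j ABD.a ∈ Acc m n (m, T) ↔ q ∈ T) := by
  induction j with
  | zero => intro T q hT h1 h2; obtain rfl : q = n - 1 := by omega
            simp [Acc, run]
  | succ j ih =>
    intro T q hT h1 h2
    have hok := ok_stp m n hm hn (m, T) ABD.a ⟨le_rfl, hT⟩
    have h := ih (stp m n (m, T) ABD.a).2 (q + 1) hok.2 (by omega) (by omega)
    have e : (stp m n (m, T) ABD.a) = (m, (stp m n (m, T) ABD.a).2) := by
      simp [stp, stK]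
    have : List.replicate (j + 1) ABD.a ∈ Acc m n (m, T) ↔
        List.replicate j ABD.a ∈ Acc m n (stp m n (m, T) ABD.a) := Iff.rfl
    rw [this, e, h, mem_stp]
    constructor
    · rintro ⟨p, hp | hp, h⟩
      · simp only [stepN] at h
        split_ifs at h
        · omega
        · obtain rfl : p = q := by omega
          exact hp
      · omega
    · intro hq
      refine ⟨q, Or.inl hq, ?_⟩
      simp only [stepN]; rw [if_neg (by omega)]

lemma dead_sub (m n : ℕ) (hm : 4 ≤ m) (hn : 4 ≤ n) (T T' : Finset ℕ)
    (hT : T ⊆ Finset.Icc 1 (n - 1)) (hT' : T' ⊆ Finset.Icc 1 (n - 1))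
    (h : Acc m n (m, T) = Acc m n (m, T')) : T = T' := by
  ext q
  by_cases hq : 1 ≤ q ∧ q ≤ n - 1
  · rw [← dead_a m n hm hn (n - 1 - q) T q hT hq.1 (by omega),
      ← dead_a m n hm hn (n - 1 - q) T' q hT' hq.1 (by omega), h]
  · constructor
    · intro h; exact absurd (Finset.mem_Icc.1 (hT h)) hq
    · intro h; exact absurd (Finset.mem_Icc.1 (hT' h)) hq

lemma mem_d (m n k : ℕ) (T : Finset ℕ) (hT : T ⊆ Finset.Icc 1 (n - 1)) (q : ℕ) :
    q ∈ (stp m n (k, T) ABD.d).2 ↔ q ∈ T ∨ (k = m - 1 ∧ q = 2) := by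
  rw [mem_stp]
  constructor
  · rintro ⟨p, hp | hp, rfl⟩
    · have := Finset.mem_Icc.1 (hT hp)
      left; simp only [stepN]; rwa [if_neg (by omega)]
    · right; simp [stepN, hp]
  · rintro (hp | hp)
    · have := Finset.mem_Icc.1 (hT hp)
      refine ⟨q, Or.inl hp, ?_⟩
      simp only [stepN]; rw [if_neg (by omega)]
    · exact ⟨0, Or.inr ⟨hp.1, rfl⟩, by simp [stepN, hp]⟩

lemma dist_d (m n : ℕ) (hm : 4 ≤ m) (hn : 4 ≤ n) (s s' : ℕ × Finset ℕ)
    (hs : Ok m n s) (hs' : Ok m n s') (h : Acc m n s = Acc m n s') (q : ℕ) :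
    (q ∈ s.2 ∨ (s.1 = m - 1 ∧ q = 2)) ↔ (q ∈ s'.2 ∨ (s'.1 = m - 1 ∧ q = 2)) := by
  have h2 := acc_stp m n ABD.d h
  have e : ∀ s, stp m n s ABD.d = (m, (stp m n s ABD.d).2) := by
    intro s; simp [stp, stK]
  rw [e s, e s'] at h2
  have h3 := dead_sub m n hm hn _ _ (ok_stp m n hm hn s ABD.d hs).2
    (ok_stp m n hm hn s' ABD.d hs').2 h2
  rw [← mem_d m n s.1 s.2 hs.2, ← mem_d m n s'.1 s'.2 hs'.2]
  rw [h3]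

lemma dist_fin (m n : ℕ) (hm : 4 ≤ m) (hn : 4 ≤ n) (s s' : ℕ × Finset ℕ)
    (hs : Ok m n s) (hs' : Ok m n s') (h1 : s.1 = m - 1) (h1' : s'.1 ≠ m - 1) :
    Acc m n s ≠ Acc m n s' := by
  intro h
  have h2 := dist_d m n hm hn _ _ (ok_stp m n hm hn s ABD.b hs) (ok_stp m n hm hn s' ABD.b hs')
    (acc_stp m n ABD.b h) 1
  obtain ⟨k, T⟩ := s
  obtain ⟨k', T'⟩ := s'
  simp only [mem_stp] at h2
  simp only at h1 h1'
  obtain ⟨p, hp, hp'⟩ := (by simpa using h2.1 (Or.inl ⟨0, Or.inr ⟨h1, rfl⟩, by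
    simp only [stepN]; rw [if_neg (by omega)]⟩))
  rcases hp with hp | hp
  · have := Finset.mem_Icc.1 (hs'.2 hp)
    simp only [stepN] at hp'
    split_ifs at hp' <;> omega
  · exact h1' hp.1

lemma dist_k (m n : ℕ) (hm : 4 ≤ m) (hn : 4 ≤ n) (j : ℕ) : ∀ (s s' : ℕ × Finset ℕ)
    (_ : Ok m n s) (_ : Ok m n s') (_ : 1 ≤ s.1) (_ : s.1 + j = m - 1) (_ : s'.1 ≠ s.1),
    Acc m n s ≠ Acc m n s' := by
  induction j with
  | zero => intro s s' hs hs' h1 h2 h3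
            exact dist_fin m n hm hn s s' hs hs' (by omega) (by omega)
  | succ j ih =>
    intro s s' hs hs' h1 h2 h3 h
    have e : (stp m n s ABD.a).1 = s.1 + 1 := by
      simp only [stp, stK, stepM]
      rw [if_neg (by simp; omega), if_neg (by omega)]
    refine ih _ _ (ok_stp m n hm hn s ABD.a hs) (ok_stp m n hm hn s' ABD.a hs') ?_ ?_ ?_
      (acc_stp m n ABD.a h)
    · omega
    · omega
    · rw [e]
      simp only [stp, stK, stepM]
      have := hs'.1
      split_ifs <;> omega

def Good (m n : ℕ) : Finset (ℕ × Finset ℕ) :=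
  insert (0, ∅) (Finset.Icc 1 m ×ˢ (Finset.Icc 1 (n - 1)).powerset)

lemma mem_Good (m n : ℕ) (s) : s ∈ Good m n ↔
    s = (0, ∅) ∨ (1 ≤ s.1 ∧ s.1 ≤ m ∧ s.2 ⊆ Finset.Icc 1 (n - 1)) := by
  simp only [Good, Finset.mem_insert, Finset.mem_product, Finset.mem_powerset, Finset.mem_Icc,
    and_assoc]

lemma good_ok (m n : ℕ) (s) (h : s ∈ Good m n) : Ok m n s := by
  rcases (mem_Good ..).1 h with rfl | h
  · exact ⟨by simp, by simp⟩
  · exact h.2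

lemma good_card (m n : ℕ) : (Good m n).card = m * 2 ^ (n - 1) + 1 := by
  unfold Good
  rw [Finset.card_insert_of_notMem (by simp), Finset.card_product, Finset.card_powerset]
  simp

lemma acc_fst (m n : ℕ) (hm : 4 ≤ m) (hn : 4 ≤ n) (s s' : ℕ × Finset ℕ)
    (hs : Ok m n s) (hs' : Ok m n s') (h : Acc m n s = Acc m n s') : s.1 = s'.1 := by
  by_contra hne
  have key : ∀ s s' : ℕ × Finset ℕ, Ok m n s → Ok m n s' → Acc m n s = Acc m n s' →
      s.1 < s'.1 → False := by
    intro s s' hs hs' h hlt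
    have h1 := hs.1
    have h2 := hs'.1
    by_cases hk : 1 ≤ s.1
    · exact dist_k m n hm hn (m - 1 - s.1) s s' hs hs' hk (by omega) (by omega) h
    · by_cases hk' : s'.1 = m
      · refine dist_k m n hm hn (m - 2) _ _ (ok_stp m n hm hn s ABD.a hs)
          (ok_stp m n hm hn s' ABD.a hs') ?_ ?_ ?_ (acc_stp m n ABD.a h) <;>
        simp only [stp, stK, stepM] <;> simp <;> (try split_ifs) <;> omega
      · exact dist_k m n hm hn (m - 1 - s'.1) s' s hs' hs (by omega) (by omega) (by omega) h.symm
  rcases lt_or_gt_of_ne hne with hlt | hlt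
  · exact key s s' hs hs' h hlt
  · exact key s' s hs' hs h.symm hlt

lemma acc_inj (m n : ℕ) (hm : 4 ≤ m) (hn : 4 ≤ n) (s s' : ℕ × Finset ℕ)
    (hs : Ok m n s) (hs' : Ok m n s') (h : Acc m n s = Acc m n s') : s = s' := by
  have h1 := acc_fst m n hm hn s s' hs hs' h
  refine Prod.ext h1 ?_
  ext q
  have hd := dist_d m n hm hn s s' hs hs' h q
  by_cases hf : s.1 = m - 1 ∧ q = 2
  · have h3 := dist_d m n hm hn _ _ (ok_stp m n hm hn s ABD.a hs) (ok_stp m n hm hn s' ABD.a hs')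
      (acc_stp m n ABD.a h) 3
    obtain ⟨k, T⟩ := s
    obtain ⟨k', T'⟩ := s'
    obtain ⟨hk, rfl⟩ := hf
    simp only at hk h1
    subst h1
    have key : ∀ T : Finset ℕ, 3 ∈ (stp m n (k, T) ABD.a).2 ↔ 2 ∈ T := by
      intro T
      rw [mem_stp]
      constructor
      · rintro ⟨p, hp, h⟩
        simp only [stepN] at h
        split_ifs at h
        · omega
        · obtain rfl : p = 2 := by omega
          simpa using hp
      · intro hp
        refine ⟨2, Or.inl hp, ?_⟩
        simp only [stepN]; rw [if_neg (by omega)]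
    rw [key, key] at h3
    simpa using h3
  · rw [h1] at hd hf
    tauto

lemma rch_stp (m n : ℕ) {s} (x) (h : Rch m n s) : Rch m n (stp m n s x) := by
  obtain ⟨w, rfl⟩ := h
  exact ⟨w ++ [x], run_snoc ..⟩

lemma rch_good (m n : ℕ) (hm : 4 ≤ m) (hn : 4 ≤ n) (w : List ABD) :
    run m n (0, ∅) w ∈ Good m n := by
  induction w using List.reverseRecOn with
  | nil => simp [run, Good]
  | append_singleton w x ih =>
    rw [run_snoc]
    have hok := good_ok _ _ _ ih
    have := ok_stp m n hm hn _ x hok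
    rw [mem_Good]; right
    refine ⟨?_, this.1, this.2⟩
    have := hok.1
    simp only [stp, stK]
    cases x <;> simp only [stepM] <;> split_ifs <;> first | omega | simp_all

/-- inverse of `a` on `1..n-1` -/
def rot (n q : ℕ) : ℕ := if q = 1 then n - 1 else q - 1

lemma rot_card (n : ℕ) (hn : 4 ≤ n) (T : Finset ℕ) (hT : T ⊆ Finset.Icc 1 (n - 1)) :
    (T.image (rot n)).card = T.card := by
  apply Finset.card_image_of_injOn
  intro p hp q hq h
  have := Finset.mem_Icc.1 (hT hp)
  have := Finset.mem_Icc.1 (hT hq)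
  simp only [rot] at h
  split_ifs at h <;> omega

lemma rot_sub (n : ℕ) (hn : 4 ≤ n) (T : Finset ℕ) (hT : T ⊆ Finset.Icc 1 (n - 1)) :
    T.image (rot n) ⊆ Finset.Icc 1 (n - 1) := by
  intro p hp
  obtain ⟨q, hq, rfl⟩ := Finset.mem_image.1 hp
  have := Finset.mem_Icc.1 (hT hq)
  rw [Finset.mem_Icc]
  simp only [rot]
  split_ifs <;> omega

lemma step_rot (n q : ℕ) (hn : 4 ≤ n) (h : 1 ≤ q) (h' : q ≤ n - 1) :
    stepN n (rot n q) ABD.a = q := by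
  simp only [stepN, rot]
  split_ifs <;> omega

lemma stp_rot (m n k : ℕ) (hn : 4 ≤ n) (T : Finset ℕ) (hT : T ⊆ Finset.Icc 1 (n - 1)) :
    (stp m n (k, T.image (rot n)) ABD.a).2 = T ∪ (if k = m - 1 then {1} else ∅) := by
  have e : (T.image (rot n)).image (fun q => stepN n q ABD.a) = T := by
    rw [Finset.image_image]
    conv_rhs => rw [← Finset.image_id (s := T)]
    apply Finset.image_congr
    intro q hq
    have := Finset.mem_Icc.1 (hT hq)
    exact step_rot n q hn this.1 this.2
  simp only [stp, Finset.image_union, e, zr]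
  split_ifs
  · have : ¬ (0 = n - 1) := by omega
    simp [stepN, this]
  · simp

lemma stK_a (m k : ℕ) (h : k < m - 1) : stK m k ABD.a = k + 1 := by
  simp only [stK, stepM]
  rw [if_neg (by simp; omega), if_neg (by omega)]

lemma rch_all_k (m n c : ℕ) (hm : 4 ≤ m) (hn : 4 ≤ n)
    (H : ∀ T ⊆ Finset.Icc 1 (n - 1), T.card = c → Rch m n (1, T)) (k : ℕ) :
    k + 1 ≤ m - 1 → ∀ T ⊆ Finset.Icc 1 (n - 1), T.card = c → Rch m n (k + 1, T) := by
  induction k with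
  | zero => intro _; exact H
  | succ k ih =>
    intro hk T hT hc
    have h := rch_stp m n ABD.a (ih (by omega) _ (rot_sub n hn T hT)
      ((rot_card n hn T hT).trans hc))
    convert h using 1
    refine Prod.ext ?_ ?_
    · simp only [stp]; rw [stK_a _ _ (by omega)]
    · rw [stp_rot m n _ hn T hT, if_neg (by omega)]; simp

lemma rch_one (m n c : ℕ) (hm : 4 ≤ m) (hn : 4 ≤ n)
    (H : ∀ T ⊆ Finset.Icc 1 (n - 1), T.card = c → Rch m n (1, T))
    (T : Finset ℕ) (hT : T ⊆ Finset.Icc 1 (n - 1)) (hc : T.card = c + 1) (h1 : 1 ∈ T) :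
    Rch m n (1, T) := by
  have hE : T.erase 1 ⊆ Finset.Icc 1 (n - 1) := (Finset.erase_subset _ _).trans hT
  have hEc : (T.erase 1).card = c := by rw [Finset.card_erase_of_mem h1, hc]; rfl
  have h := rch_stp m n ABD.a (rch_all_k m n c hm hn H (m - 2) (by omega) _
    (rot_sub n hn _ hE) ((rot_card n hn _ hE).trans hEc))
  convert h using 1
  refine Prod.ext ?_ ?_
  · simp only [stp, stK, stepM]
    rw [if_neg (by simp; omega), if_pos (by omega)]
  · rw [stp_rot m n _ hn _ hE, if_pos (by omega)]
    ext q
    simp only [Finset.mem_union, Finset.mem_erase, Finset.mem_singleton]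
    by_cases hq : q = 1
    · simp [hq, h1]
    · simp [hq]

/-- inverse of `ab` -/
def sh (x q : ℕ) : ℕ := if q = 2 then x else q - 2

lemma sh_spec (n x : ℕ) (hn : 4 ≤ n) (hx : x = n - 1 ∨ x = n - 2)
    (T : Finset ℕ) (hT : T ⊆ Finset.Icc 1 (n - 1)) (h1 : 1 ∉ T) :
    T.image (sh x) ⊆ Finset.Icc 1 (n - 1) ∧ (T.image (sh x)).card = T.card := by
  have hb : ∀ q ∈ T, 2 ≤ q ∧ q ≤ n - 1 := by
    intro q hq
    have := Finset.mem_Icc.1 (hT hq)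
    have : q ≠ 1 := by rintro rfl; exact h1 hq
    omega
  constructor
  · intro p hp
    obtain ⟨q, hq, rfl⟩ := Finset.mem_image.1 hp
    have := hb q hq
    rw [Finset.mem_Icc]
    simp only [sh]
    split_ifs <;> omega
  · apply Finset.card_image_of_injOn
    intro p hp q hq h
    have := hb p hp
    have := hb q hq
    simp only [sh] at h
    split_ifs at h <;> omega

lemma sh_rch (m n x : ℕ) (hm : 4 ≤ m) (hn : 4 ≤ n) (hx : x = n - 1 ∨ x = n - 2)
    (T : Finset ℕ) (hT : T ⊆ Finset.Icc 1 (n - 1)) (h1 : 1 ∉ T)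
    (h : Rch m n (1, T.image (sh x))) : Rch m n (1, T) := by
  have h2 := rch_stp m n ABD.b (rch_stp m n ABD.a h)
  convert h2 using 1
  have k1 : stK m 1 ABD.a = 2 := stK_a m 1 (by omega)
  have k2 : stK m 2 ABD.b = 1 := by
    simp only [stK, stepM]
    rw [if_neg (by simp; omega)]; simp
  have z1 : zr m 1 = ∅ := by unfold zr; rw [if_neg (by omega)]
  have z2 : zr m 2 = ∅ := by unfold zr; rw [if_neg (by omega)]
  simp only [stp, k1, k2, z1, z2, Finset.union_empty]
  congr 1
  rw [Finset.image_image, Finset.image_image]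
  conv_lhs => rw [← Finset.image_id (s := T)]
  apply Finset.image_congr
  intro q hq
  have := Finset.mem_Icc.1 (hT hq)
  have : q ≠ 1 := by rintro rfl; exact h1 hq
  simp only [id, Function.comp, stepN, sh]
  split_ifs <;> omega

lemma rch_odd (m n c : ℕ) (hm : 4 ≤ m) (hn : 4 ≤ n)
    (H : ∀ T ⊆ Finset.Icc 1 (n - 1), T.card = c → Rch m n (1, T)) (j : ℕ) :
    ∀ T ⊆ Finset.Icc 1 (n - 1), T.card = c + 1 → 2 * j + 1 ∈ T → Rch m n (1, T) := by
  induction j with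
  | zero => intro T hT hc h; exact rch_one m n c hm hn H T hT hc h
  | succ j ih =>
    intro T hT hc h
    by_cases h1 : 1 ∈ T
    · exact rch_one m n c hm hn H T hT hc h1
    · obtain ⟨s1, s2⟩ := sh_spec n (n - 1) hn (Or.inl rfl) T hT h1
      refine sh_rch m n (n - 1) hm hn (Or.inl rfl) T hT h1 (ih _ s1 (s2.trans hc) ?_)
      refine Finset.mem_image.2 ⟨_, h, ?_⟩
      simp only [sh]; rw [if_neg (by omega)]; omega

lemma rch_even (m n c : ℕ) (hm : 4 ≤ m) (hn : 4 ≤ n)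
    (H : ∀ T ⊆ Finset.Icc 1 (n - 1), T.card = c → Rch m n (1, T)) (j : ℕ) :
    ∀ T ⊆ Finset.Icc 1 (n - 1), T.card = c + 1 → 2 * j + 2 ∈ T → Rch m n (1, T) := by
  induction j with
  | zero =>
    intro T hT hc h
    by_cases h1 : 1 ∈ T
    · exact rch_one m n c hm hn H T hT hc h1
    · obtain ⟨x, hx, i, hi⟩ : ∃ x, (x = n - 1 ∨ x = n - 2) ∧ ∃ i, x = 2 * i + 1 := by
        rcases Nat.even_or_odd' n with ⟨i, hi | hi⟩
        · exact ⟨n - 1, Or.inl rfl, i - 1, by omega⟩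
        · exact ⟨n - 2, Or.inr rfl, i - 1, by omega⟩
      obtain ⟨s1, s2⟩ := sh_spec n x hn hx T hT h1
      refine sh_rch m n x hm hn hx T hT h1 (rch_odd m n c hm hn H i _ s1 (s2.trans hc) ?_)
      exact Finset.mem_image.2 ⟨_, h, by simp [sh, hi]⟩
  | succ j ih =>
    intro T hT hc h
    by_cases h1 : 1 ∈ T
    · exact rch_one m n c hm hn H T hT hc h1
    · obtain ⟨s1, s2⟩ := sh_spec n (n - 1) hn (Or.inl rfl) T hT h1
      refine sh_rch m n (n - 1) hm hn (Or.inl rfl) T hT h1 (ih _ s1 (s2.trans hc) ?_)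
      refine Finset.mem_image.2 ⟨_, h, ?_⟩
      simp only [sh]; rw [if_neg (by omega)]; omega

lemma rch_first (m n : ℕ) (hm : 4 ≤ m) (hn : 4 ≤ n) (c : ℕ) :
    ∀ T ⊆ Finset.Icc 1 (n - 1), T.card = c → Rch m n (1, T) := by
  induction c with
  | zero =>
    intro T _ hc
    obtain rfl := Finset.card_eq_zero.1 hc
    refine ⟨[ABD.a], ?_⟩
    have z : zr m 0 = ∅ := by unfold zr; rw [if_neg (by omega)]
    simp [run, stp, z, stK_a m 0 (by omega)]
  | succ c ih =>
    intro T hT hc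
    obtain ⟨e, he⟩ : T.Nonempty := Finset.card_pos.1 (by omega)
    have h1 := (Finset.mem_Icc.1 (hT he)).1
    rcases Nat.even_or_odd' e with ⟨i, rfl | rfl⟩
    · refine rch_even m n c hm hn ih (i - 1) T hT hc ?_
      rwa [show 2 * (i - 1) + 2 = 2 * i by omega]
    · exact rch_odd m n c hm hn ih i T hT hc he

lemma good_rch (m n : ℕ) (hm : 4 ≤ m) (hn : 4 ≤ n) (s) (h : s ∈ Good m n) : Rch m n s := by
  rcases (mem_Good ..).1 h with rfl | ⟨h1, h2, h3⟩
  · exact ⟨[], rfl⟩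
  · obtain ⟨k, T⟩ := s
    simp only at h1 h2 h3
    by_cases hk : k = m
    · subst hk
      have h := rch_stp k n ABD.d (rch_first k n hm hn _ T h3 rfl)
      convert h using 1
      refine Prod.ext (by simp [stp, stK]) ?_
      ext q
      rw [mem_d k n 1 T h3]
      simp; omega
    · have := rch_all_k m n _ hm hn (rch_first m n hm hn T.card) (k - 1) (by omega) T h3 rfl
      rwa [Nat.sub_add_cancel h1] at this

end Prod16

open Prod16 in
/-- The unrestricted product `L'_m(a,b) · L_n(a,-,b,d)`, regarded as a language over
`{a,b,d}`, has state complexity exactly `m·2^{n-1} + 1`. -/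
theorem stmt16 (m n : ℕ) (hm : 4 ≤ m) (hn : 4 ≤ n) :
    stateComplexity (concat (LmAB m) (LnABD n)) = m * 2 ^ (n - 1) + 1 := by
  have hq : quotients (concat (LmAB m) (LnABD n)) = Acc m n '' (Good m n : Set (ℕ × Finset ℕ)) := by
    ext K
    constructor
    · rintro ⟨w, rfl⟩
      exact ⟨_, rch_good m n hm hn w, (leftQuot_eq m n hm hn w).symm⟩
    · rintro ⟨s, hs, rfl⟩
      obtain ⟨w, rfl⟩ := good_rch m n hm hn s hs
      exact ⟨w, leftQuot_eq m n hm hn w⟩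
  have hinj : Set.InjOn (Acc m n) (Good m n : Set (ℕ × Finset ℕ)) := by
    intro s hs s' hs' h
    exact acc_inj m n hm hn s s' (good_ok _ _ _ hs) (good_ok _ _ _ hs') h
  rw [stateComplexity, hq, Nat.card_image_of_injOn hinj]
  rw [← good_card m n]
  simp
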